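/- For every g ∈ K((x))_1^*, the Coleman trace of the logarithmic derivative satisfies 𝒯(dlog g) = η · dlog(𝒩 g), where dlog g := g'/g. -/

import Mathlib

open Polynomial
open scoped Classical

namespace ColemanDrinfeld

variable {Cp : Type*} [NontriviallyNormedField Cp] [CompleteSpace Cp]

/-- Additive valuation on `Cp` normalized so that `v(F_𝔭^*) = ℤ`:
`v x = -log ‖x‖ / log q_𝔭`, with `v 0 = ⊤`. -/
noncomputable def val (qp : ℕ) (x : Cp) : WithTop ℝ :=
  if x = 0 then ⊤ else ((-(Real.log ‖x‖ / Real.log qp) : ℝ) : WithTop ℝ)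

/-- Evaluation of a polynomial, as a function. -/
def ev (P : Polynomial Cp) (z : Cp) : Cp := P.eval z

/-- The `𝔭^{fk}`-torsion `Φ[𝔭^{fk}]`: the zeros of the `k`-fold iterate of `Φ_η`. -/
def tors (P : Polynomial Cp) (k : ℕ) : Set Cp := {u : Cp | (ev P)^[k] u = 0}

/-- The punctured open unit ball `B' = {z : 0 < |z| < 1}`. -/
def inB' (z : Cp) : Prop := z ≠ 0 ∧ ‖z‖ < 1

/-- Field trace for an extension of subfields of `Cp`. -/
noncomputable def tr {E L : Subfield Cp} (h : E ≤ L) (x : L) : E :=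
  letI : Algebra E L := (Subfield.inclusion h).toAlgebra
  Algebra.trace E L x

/-- Field norm for an extension of subfields of `Cp`. -/
noncomputable def nrm {E L : Subfield Cp} (h : E ≤ L) (x : L) : E :=
  letI : Algebra E L := (Subfield.inclusion h).toAlgebra
  Algebra.norm E x

/-- The ring `K((x))₁` of Laurent series with coefficients in `K` converging on the
punctured open unit ball `B'`. -/
structure LSer (K : Subfield Cp) where
  coeff : ℤ → Cp
  mem : ∀ i, coeff i ∈ K
  bdd : ∃ N : ℤ, ∀ i < N, coeff i = 0
  conv : ∀ z : Cp, inB' z → Summable fun i : ℤ => coeff i * z ^ i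

/-- Evaluation of a convergent Laurent series. -/
noncomputable def LSer.eval {K : Subfield Cp} (g : LSer K) (z : Cp) : Cp :=
  ∑' i : ℤ, g.coeff i * z ^ i

/-- `g` is a unit of `K((x))₁`. -/
def IsUnitL {K : Subfield Cp} (g : LSer K) : Prop :=
  ∃ h : LSer K, ∀ z : Cp, inB' z → g.eval z * h.eval z = 1

/-- `g` lies in `O((x))^* = x^ℤ × O[[x]]^*`: integral coefficients, and the lowest
nonvanishing coefficient is a unit of `O`. -/
def OUnitL {K : Subfield Cp} (g : LSer K) : Prop :=
  (∀ i, ‖g.coeff i‖ ≤ 1) ∧ ∃ m : ℤ, (∀ i < m, g.coeff i = 0) ∧ ‖g.coeff m‖ = 1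

section LaurentSeries

variable {k : Type*} [NontriviallyNormedField k]

/-- `F` is given on the punctured open unit ball by a convergent Laurent series. -/
def IsLaurent (F : k → k) : Prop :=
  ∃ a : ℤ → k, (∃ N : ℤ, ∀ i < N, a i = 0) ∧
    ∀ z : k, inB' z → HasSum (fun i : ℤ => a i * z ^ i) (F z)

theorem LSer.hasSum_eval {K : Subfield k} (g : LSer K) {z : k} (hz : inB' z) :
    HasSum (fun i : ℤ => g.coeff i * z ^ i) (g.eval z) :=
  (g.conv z hz).hasSum

theorem LSer.isLaurent {K : Subfield k} (g : LSer K) : IsLaurent g.eval :=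
  ⟨g.coeff, g.bdd, fun _ hz => g.hasSum_eval hz⟩

theorem isLaurent_const (c : k) : IsLaurent fun _ => c := by
  refine ⟨fun i => if i = 0 then c else 0, ⟨0, fun i hi => if_neg hi.ne⟩, fun z _ => ?_⟩
  convert hasSum_single (f := fun i : ℤ => (if i = 0 then c else 0) * z ^ i) 0 ?_ using 1
  · simp
  · intro i hi
    simp [hi]

theorem IsLaurent.sub {F G : k → k} (hF : IsLaurent F) (hG : IsLaurent G) :
    IsLaurent fun z => F z - G z := by
  obtain ⟨a, ⟨M, ha⟩, hF⟩ := hF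
  obtain ⟨b, ⟨N, hb⟩, hG⟩ := hG
  refine ⟨fun i => a i - b i, ⟨min M N, fun i hi => ?_⟩, fun z hz => ?_⟩
  · beta_reduce
    rw [ha i (hi.trans_le (min_le_left _ _)), hb i (hi.trans_le (min_le_right _ _)), sub_zero]
  · simpa only [sub_mul] using (hF z hz).sub (hG z hz)

theorem IsLaurent.mul [CompleteSpace k] [IsUltrametricDist k] {F G : k → k} (hF : IsLaurent F)
    (hG : IsLaurent G) : IsLaurent fun z => F z * G z := by
  have : NonarchimedeanRing k := ⟨NonarchimedeanAddGroup.is_nonarchimedean⟩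
  obtain ⟨a, ⟨M, ha⟩, hF⟩ := hF
  obtain ⟨b, ⟨N, hb⟩, hG⟩ := hG
  refine ⟨fun n => ∑' i, a i * b (n - i), ⟨M + N, fun n hn => ?_⟩, fun z hz => ?_⟩
  · convert tsum_zero with i
    rcases lt_or_ge i M with hi | hi
    · rw [ha i hi, zero_mul]
    · rw [hb (n - i) (by lia), mul_zero]
  · let e : ℤ × ℤ ≃ ℤ × ℤ :=
      { toFun := fun p => (p.2, p.1 - p.2)
        invFun := fun p => (p.1 + p.2, p.1)
        left_inv := fun p => by simp
        right_inv := fun p => by simp }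
    have h1 := e.hasSum_iff.2 ((hF z hz).mul_of_nonarchimedean (hG z hz))
    have h2 : HasSum (fun p : ℤ × ℤ => a p.2 * b (p.1 - p.2) * z ^ p.1) (F z * G z) := by
      refine h1.congr_fun fun p => ?_
      have : z ^ p.1 = z ^ p.2 * z ^ (p.1 - p.2) := by
        rw [← zpow_add₀ hz.1]
        congr 1
        ring
      simp only [Function.comp, e, Equiv.coe_fn_mk]
      rw [this]
      ring
    refine h2.prod_fiberwise fun n => ?_
    have h3 := (h2.summable.prod_factor n).hasSum
    dsimp only at h3 ⊢
    rwa [tsum_mul_right] at h3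

theorem norm_one_add_zpow_sub_le [IsUltrametricDist k] {u : k} (hu : ‖u‖ < 1) (i : ℤ) :
    ‖(1 + u) ^ i - 1 - i * u‖ ≤ ‖u‖ ^ 2 := by
  have h1 : ‖1 + u‖ = 1 := by
    have := IsUltrametricDist.norm_add_eq_max_of_norm_ne_norm (x := (1 : k)) (y := u)
      (by rw [norm_one]; exact hu.ne')
    rw [this, norm_one, max_eq_left hu.le]
  have h0 : 1 + u ≠ 0 := by
    rw [← norm_ne_zero_iff, h1]
    exact one_ne_zero
  have hn (n : ℤ) : ‖(n : k) * u ^ 2‖ ≤ ‖u‖ ^ 2 := by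
    rw [norm_mul, norm_pow]
    exact mul_le_of_le_one_left (by positivity) (IsUltrametricDist.norm_intCast_le_one k n)
  have key (n : ℤ) : (1 + u) ^ (n + 1) - 1 - ((n + 1 : ℤ) : k) * u =
      (1 + u) * ((1 + u) ^ n - 1 - n * u) + n * u ^ 2 := by
    rw [zpow_add_one₀ h0]
    push_cast
    ring
  have step (n : ℤ) : ‖(1 + u) ^ (n + 1) - 1 - ((n + 1 : ℤ) : k) * u‖ ≤ ‖u‖ ^ 2 ↔
      ‖(1 + u) ^ n - 1 - n * u‖ ≤ ‖u‖ ^ 2 := by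
    refine ⟨fun h => ?_, fun h => ?_⟩
    · have h2 := key n
      rw [← sub_eq_iff_eq_add] at h2
      rw [← one_mul ‖(1 + u) ^ n - 1 - n * u‖, ← h1, ← norm_mul, ← h2,
        sub_eq_add_neg]
      exact (IsUltrametricDist.norm_add_le_max _ _).trans (max_le h (by rw [norm_neg]; exact hn n))
    · rw [key]
      refine (IsUltrametricDist.norm_add_le_max _ _).trans (max_le ?_ (hn n))
      rwa [norm_mul, h1, one_mul]
  induction i using Int.induction_on with
  | zero => simp
  | succ n ih => exact (step n).2 ih
  | pred n ih => exact (step _).1 (by simpa using ih)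

theorem IsLaurent.exists_hasDerivAt [CompleteSpace k] [IsUltrametricDist k] {F : k → k}
    (hF : IsLaurent F) :
    ∃ D : k → k, IsLaurent D ∧ ∀ z, inB' z → HasDerivAt F (D z) z := by
  obtain ⟨a, ⟨M, ha⟩, hF⟩ := hF
  have hS (z : k) (hz : inB' z) : Summable fun i : ℤ => (i : k) * (a i * z ^ i) := by
    apply NonarchimedeanAddGroup.summable_of_tendsto_cofinite_zero
    refine squeeze_zero_norm (fun i => ?_)
      (tendsto_zero_iff_norm_tendsto_zero.1 (hF z hz).summable.tendsto_cofinite_zero)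
    rw [norm_mul]
    exact mul_le_of_le_one_left (norm_nonneg _) (IsUltrametricDist.norm_intCast_le_one k i)
  refine ⟨fun z => (∑' i : ℤ, (i : k) * (a i * z ^ i)) / z,
    ⟨fun i => ((i + 1 : ℤ) : k) * a (i + 1), ⟨M - 1, fun i hi => ?_⟩, fun z hz => ?_⟩,
    fun z hz => ?_⟩
  · beta_reduce
    rw [ha (i + 1) (by lia), mul_zero]
  · refine ((Equiv.addRight (1 : ℤ)).hasSum_iff.2 ((hS z hz).hasSum.div_const z)).congr_fun
      fun i => ?_
    simp only [Function.comp, Equiv.coe_addRight, zpow_add_one₀ hz.1]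
    field_simp [hz.1]
  · have hz0 : 0 < ‖z‖ := norm_pos_iff.2 hz.1
    obtain ⟨C, hC⟩ := (hF z hz).summable.tendsto_cofinite_zero.norm.bddAbove_range_of_cofinite
    replace hC (i : ℤ) : ‖a i * z ^ i‖ ≤ C := hC ⟨i, rfl⟩
    rw [hasDerivAt_iff_isLittleO_nhds_zero]
    refine Asymptotics.IsBigO.trans_isLittleO (g := fun h : k => h ^ 2) ?_ ?_
    · refine Asymptotics.IsBigO.of_bound (C / ‖z‖ ^ 2) ?_
      filter_upwards [Metric.ball_mem_nhds (0 : k) hz0] with h hh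
      rw [mem_ball_zero_iff] at hh
      have hu : ‖h / z‖ < 1 := by rwa [norm_div, div_lt_one hz0]
      have hzh : z + h = z * (1 + h / z) := by field_simp [hz.1]
      have hB : inB' (z + h) := by
        have : ‖z + h‖ = ‖z‖ := by
          rw [IsUltrametricDist.norm_add_eq_max_of_norm_ne_norm hh.ne', max_eq_left hh.le]
        exact ⟨by rw [← norm_pos_iff, this]; exact hz0, this ▸ hz.2⟩
      have hsum := (((hF _ hB).sub (hF z hz)).sub ((hS z hz).hasSum.mul_left (h / z)))
      have hval : F (z + h) - F z - h • ((∑' i : ℤ, (i : k) * (a i * z ^ i)) / z) =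
          ∑' i : ℤ, a i * z ^ i * ((1 + h / z) ^ i - 1 - i * (h / z)) := by
        rw [smul_eq_mul, mul_div_assoc', ← div_mul_eq_mul_div, ← hsum.tsum_eq]
        refine tsum_congr fun i => ?_
        rw [hzh, mul_zpow]
        ring
      rw [hval]
      have hC0 : 0 ≤ C := (norm_nonneg _).trans (hC 0)
      refine IsUltrametricDist.norm_tsum_le_of_forall_le fun i => ?_
      rw [norm_mul]
      calc _ ≤ C * ‖h / z‖ ^ 2 :=
            mul_le_mul (hC i) (norm_one_add_zpow_sub_le hu i) (norm_nonneg _) hC0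
        _ = C / ‖z‖ ^ 2 * ‖h ^ 2‖ := by rw [norm_div, norm_pow]; ring
    · simpa using Asymptotics.isLittleO_pow_id (𝕜 := k) (n := 2) (by norm_num)

/-- Identity principle for Laurent series on the punctured open unit ball. -/
theorem IsLaurent.eq_zero [IsUltrametricDist k] {F : k → k} (hF : IsLaurent F) {U : Set k}
    (hU : U ∈ nhds 0) (h0 : ∀ z ∈ U, inB' z → F z = 0) {z : k} (hz : inB' z) : F z = 0 := by
  obtain ⟨a, ⟨M, ha⟩, hF⟩ := hF
  suffices h : ∀ i, a i = 0 by
    refine (hF z hz).unique ?_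
    simp [h]
  by_contra! hne
  obtain ⟨m, hm, hmin⟩ := Int.exists_least_of_bdd (P := fun i => a i ≠ 0)
    ⟨M, fun i hi => by
      by_contra! h
      exact hi (ha i h)⟩ hne
  have hz0 : 0 < ‖z‖ := norm_pos_iff.2 hz.1
  obtain ⟨C, hC⟩ := (hF z hz).summable.tendsto_cofinite_zero.norm.bddAbove_range_of_cofinite
  replace hC (i : ℤ) : ‖a i * z ^ i‖ ≤ C := hC ⟨i, rfl⟩
  have hC0 : 0 ≤ C := (norm_nonneg _).trans (hC 0)
  set C' := C * ‖z ^ (-m - 1)‖ with hC'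
  have hC'0 : 0 ≤ C' := by positivity
  have hbound : ∀ w ∈ U, w ≠ 0 → ‖w‖ < ‖z‖ → ‖a m‖ ≤ ‖w‖ * C' := by
    intro w hwU hw hwz
    have hB : inB' w := ⟨hw, hwz.trans hz.2⟩
    have hs := (hF w hB).mul_right (w ^ (-m))
    rw [h0 w hwU hB, zero_mul] at hs
    have hs' := hs.sub (hasSum_ite_eq m (a m))
    rw [zero_sub] at hs'
    rw [← norm_neg, ← hs'.tsum_eq]
    refine IsUltrametricDist.norm_tsum_le_of_forall_le fun i => ?_
    rcases lt_trichotomy i m with hi | rfl | hi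
    · have : a i = 0 := by
        by_contra h
        exact absurd (hmin i h) (not_le.2 hi)
      simp only [this, hi.ne, if_false, zero_mul, sub_zero, norm_zero]
      positivity
    · rw [if_pos rfl, mul_assoc, ← zpow_add₀ hw, add_neg_cancel, zpow_zero, mul_one, sub_self,
        norm_zero]
      positivity
    · obtain ⟨n, hn⟩ := Int.eq_ofNat_of_zero_le (show 0 ≤ i - m - 1 by lia)
      have e1 : w ^ i * w ^ (-m) = w * w ^ n := by
        rw [← zpow_add₀ hw, ← zpow_natCast, ← zpow_one_add₀ hw]
        congr 1
        lia
      have e2 : z ^ n = z ^ i * z ^ (-m - 1) := by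
        rw [← zpow_add₀ hz.1, ← zpow_natCast]
        congr 1
        lia
      rw [if_neg hi.ne', sub_zero, mul_assoc, e1, mul_left_comm, norm_mul]
      gcongr
      calc ‖a i * w ^ n‖ ≤ ‖a i * z ^ n‖ := by
            rw [norm_mul, norm_mul, norm_pow, norm_pow]
            gcongr
        _ = ‖a i * z ^ i‖ * ‖z ^ (-m - 1)‖ := by rw [e2, ← mul_assoc, norm_mul]
        _ ≤ C' := by rw [hC']; gcongr; exact hC i
  obtain ⟨δ, hδ, hδU⟩ := Metric.mem_nhds_iff.1 hU
  have ham : 0 < ‖a m‖ := norm_pos_iff.2 hm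
  obtain ⟨w, hw0, hw⟩ := NormedField.exists_norm_lt k
    (show 0 < min (min δ ‖z‖) (‖a m‖ / (C' + 1)) by positivity)
  rw [lt_min_iff, lt_min_iff, lt_div_iff₀ (by positivity)] at hw
  have := hbound w (hδU (by simpa using hw.1.1)) (norm_pos_iff.1 hw0) hw.1.2
  nlinarith

/-- A nontrivially normed field carrying an additive monic polynomial of degree at least two
is ultrametric. -/
theorem isUltrametricDist_of_additive {P : Polynomial k} (hP : P.Monic) (hd : 1 < P.natDegree)
    (hadd : ∀ x y : k, P.eval (x + y) = P.eval x + P.eval y) : IsUltrametricDist k := by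
  refine IsUltrametricDist.isUltrametricDist_of_forall_norm_natCast_le_one fun n => ?_
  have hcomp : P.comp (C (n : k) * X) = C (n : k) * P := by
    refine Polynomial.funext fun x => ?_
    have := map_nsmul (AddMonoidHom.mk' (fun x => P.eval x) hadd) n x
    simpa using this
  have hcoeff := congrArg (fun Q => Q.coeff P.natDegree) hcomp
  simp only [comp_C_mul_X_coeff, coeff_C_mul, hP.coeff_natDegree, one_mul, mul_one] at hcoeff
  by_contra! h
  have h2 := congrArg norm hcoeff
  rw [norm_pow] at h2
  exact absurd h2 (lt_self_pow₀ h hd).ne'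

theorem norm_root_lt_one [IsUltrametricDist k] {P : Polynomial k} (hP : P.Monic)
    (hd : 0 < P.natDegree) (hc : ∀ i < P.natDegree, ‖P.coeff i‖ < 1) {t : k}
    (ht : P.eval t = 0) : ‖t‖ < 1 := by
  by_contra! h
  rw [eval_eq_sum_range, Finset.sum_range_succ, hP.coeff_natDegree, one_mul,
    add_eq_zero_iff_eq_neg'] at ht
  obtain ⟨i, hi, hle⟩ := IsUltrametricDist.exists_norm_finsetSum_le_of_nonempty
    (Finset.nonempty_range_iff.2 hd.ne') fun i => P.coeff i * t ^ i
  rw [Finset.mem_range] at hi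
  have h1 : ‖P.coeff i * t ^ i‖ < ‖t ^ P.natDegree‖ := by
    rw [norm_mul, norm_pow, norm_pow]
    calc _ < 1 * ‖t‖ ^ i := by
          have := hc i hi
          gcongr
      _ ≤ _ := by rw [one_mul]; exact pow_le_pow_right₀ h hi.le
  rw [ht, norm_neg] at h1
  exact absurd hle (not_le.2 h1)

theorem isOpen_inB' : IsOpen {z : k | inB' z} :=
  isOpen_ne.inter (isOpen_lt continuous_norm continuous_const)

end LaurentSeries

theorem trace_dlog
    (q qp f : ℕ) (hq : 1 < q) (hqp : 1 < qp) (hf : 0 < f)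
    (Fp K : Subfield Cp) (hFpK : Fp ≤ K)
    (η : Cp) (hηF : η ∈ Fp) (hηnorm : ‖η‖ = (qp : ℝ) ^ (-(f : ℤ)))
    (Φη : Polynomial Cp) (hmonic : Φη.Monic) (hdeg : Φη.natDegree = qp ^ f)
    (hcoeffK : ∀ i, Φη.coeff i ∈ K) (hcoeffint : ∀ i, ‖Φη.coeff i‖ ≤ 1)
    (hcoeffm : ∀ i, i < qp ^ f → ‖Φη.coeff i‖ < 1)
    (haddpoly : ∀ x y : Cp, Φη.eval (x + y) = Φη.eval x + Φη.eval y)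
    (hlin : Φη.coeff 1 = η)
    (htors : ∀ k, (tors Φη k).Finite)
    (T N : LSer K → LSer K)
    (hT : ∀ (g : LSer K) (z : Cp), inB' z → ev Φη z ≠ 0 →
      ∑ t ∈ (htors 1).toFinset, g.eval (z + t) = (T g).eval (ev Φη z))
    (hN : ∀ (g : LSer K) (z : Cp), inB' z → ev Φη z ≠ 0 →
      ∏ t ∈ (htors 1).toFinset, g.eval (z + t) = (N g).eval (ev Φη z))
        (g dg : LSer K) (hg : IsUnitL g)
    (hdg : ∀ z : Cp, inB' z → dg.eval z = deriv (LSer.eval g) z / g.eval z) :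
    ∀ z : Cp, inB' z →
      (T dg).eval z = η * (deriv (LSer.eval (N g)) z / (N g).eval z) := by
  have hd : 1 < Φη.natDegree := hdeg ▸ one_lt_pow₀ hqp hf.ne'
  have : IsUltrametricDist Cp := isUltrametricDist_of_additive hmonic hd haddpoly
  have hη : η ≠ 0 := by
    rw [← norm_pos_iff, hηnorm]
    have : (0 : ℝ) < qp := by exact_mod_cast (zero_lt_one.trans hqp)
    positivity
  have hΦ0 : Φη.eval 0 = 0 := by simpa using haddpoly 0 0
  have hΦd0 : HasStrictDerivAt (ev Φη) η 0 := by
    have := Φη.hasStrictDerivAt 0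
    rwa [← coeff_zero_eq_eval_zero, coeff_derivative, zero_add, hlin, Nat.cast_zero, zero_add,
      mul_one] at this
  have hΦd (z : Cp) : HasDerivAt (ev Φη) η z := by
    have h1 : HasDerivAt (fun x => ev Φη (x - z)) η z :=
      HasDerivAt.comp_sub_const z z (by rw [sub_self]; exact hΦd0.hasDerivAt)
    refine (h1.const_add (ev Φη z)).congr_of_eventuallyEq (Filter.Eventually.of_forall fun x => ?_)
    simp only [ev]
    rw [← haddpoly, add_sub_cancel]
  have hmem {t : Cp} (ht : t ∈ (htors 1).toFinset) : Φη.eval t = 0 := by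
    simpa [tors, ev] using ht
  have hshift {z : Cp} (hz : inB' z) (hz0 : ev Φη z ≠ 0) {t : Cp}
      (ht : t ∈ (htors 1).toFinset) : inB' (z + t) := by
    refine ⟨fun h => hz0 ?_, ?_⟩
    · have := haddpoly z t
      rwa [h, hΦ0, hmem ht, add_zero, eq_comm] at this
    · exact (IsUltrametricDist.norm_add_le_max z t).trans_lt
        (max_lt hz.2 (norm_root_lt_one hmonic (by lia) (fun i hi => hcoeffm i (hdeg ▸ hi))
          (hmem ht)))
  obtain ⟨h, hgh⟩ := hg
  obtain ⟨D, hDL, hD⟩ := (N g).isLaurent.exists_hasDerivAt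
  obtain ⟨E, -, hE⟩ := g.isLaurent.exists_hasDerivAt
  let U : Set Cp := ev Φη '' Metric.ball 0 1
  have hU : U ∈ nhds 0 := by
    have h1 := hΦd0.map_nhds_eq hη
    rw [show ev Φη 0 = 0 from hΦ0] at h1
    rw [← h1]
    exact Filter.image_mem_map (Metric.ball_mem_nhds 0 one_pos)
  have hUz {w : Cp} (hwU : w ∈ U) (hw : inB' w) : ∃ z, inB' z ∧ ev Φη z = w := by
    obtain ⟨z, hz, rfl⟩ := hwU
    refine ⟨z, ⟨?_, by simpa using hz⟩, rfl⟩
    rintro rfl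
    exact hw.1 hΦ0
  have hunit {w : Cp} (hw : inB' w) : (N g).eval w * (N h).eval w = 1 := by
    refine sub_eq_zero.1 ((((N g).isLaurent.mul (N h).isLaurent).sub
      (isLaurent_const 1)).eq_zero hU (fun w hwU hw => ?_) hw)
    obtain ⟨z, hz, rfl⟩ := hUz hwU hw
    rw [← hN g z hz hw.1, ← hN h z hz hw.1, ← Finset.prod_mul_distrib,
      Finset.prod_eq_one fun t ht => hgh _ (hshift hz hw.1 ht), sub_self]
  have hprod {w : Cp} (hw : inB' w) : (T dg).eval w * (N g).eval w = η * D w := by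
    refine sub_eq_zero.1 ((((T dg).isLaurent.mul (N g).isLaurent).sub
      ((isLaurent_const η).mul hDL)).eq_zero hU (fun w hwU hw => ?_) hw)
    obtain ⟨z, hz, rfl⟩ := hUz hwU hw
    rw [sub_eq_zero]
    have hl : HasDerivAt (fun x => ∏ t ∈ (htors 1).toFinset, g.eval (x + t))
        (∑ t ∈ (htors 1).toFinset,
          (∏ s ∈ (htors 1).toFinset.erase t, g.eval (z + s)) • E (z + t)) z :=
      HasDerivAt.fun_finsetProd fun t ht =>
        HasDerivAt.comp_add_const z t (hE _ (hshift hz hw.1 ht))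
    have hr : HasDerivAt (fun x => (N g).eval (ev Φη x)) (D (ev Φη z) * η) z :=
      (hD _ hw).comp z (hΦd z)
    have hev : (fun x => ∏ t ∈ (htors 1).toFinset, g.eval (x + t)) =ᶠ[nhds z]
        fun x => (N g).eval (ev Φη x) := by
      filter_upwards [isOpen_inB'.mem_nhds hz,
        (hΦd z).continuousAt.eventually_ne hw.1] with x hx hx0
      exact hN g x hx hx0
    rw [mul_comm η, ← hr.unique (hl.congr_of_eventuallyEq hev.symm) |>.symm, ← hT dg z hz hw.1,
      ← hN g z hz hw.1, Finset.sum_mul]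
    refine Finset.sum_congr rfl fun t ht => ?_
    have hB := hshift hz hw.1 ht
    have hne : g.eval (z + t) ≠ 0 := left_ne_zero_of_mul (hgh _ hB ▸ one_ne_zero)
    rw [hdg _ hB, (hE _ hB).deriv, ← Finset.mul_prod_erase _ _ ht, smul_eq_mul]
    field_simp
  intro z hz
  have hne : (N g).eval z ≠ 0 := left_ne_zero_of_mul (hunit hz ▸ one_ne_zero)
  rw [(hD z hz).deriv, ← mul_div_assoc, ← hprod hz, mul_div_cancel_right₀ _ hne]

end ColemanDrinfeld
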